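/- (Theorem 1, case m = M, key inequality.) Fix integers B ≥ 1, C ≥ 1 and m ≥ 1 and a real step size α > BC/(4m). Let y_i ∈ ℝ^C (i = 1,…,B) be one-hot vectors and let a_{j,i} ∈ ℝ^C (j = 1,…,m, i = 1,…,B) be one-hot vectors such that a_{j,i} = y_i for all j and all i ≤ B−1, and suppose there is a single one-hot vector e ≠ y_B with a_{j,B} = e for every j = 1,…,m. Let w ∈ ℝ^m satisfy w_j ≥ 0 for all j and Σ_{j=1}^m w_j = 1, and write f_w(i) = Σ_{k=1}^m w_k a_{k,i}. Define g_j := (2/(BC)) Σ_{i=1}^B ⟨f_w(i) − y_i, a_{j,i}⟩ for j ≤ m and g_{m+1} := (2/(BC)) Σ_{i=1}^B ⟨f_w(i) − y_i, y_i⟩, and define u ∈ ℝ^{m+1} by u_j = w_j − α·g_j for j ≤ m and u_{m+1} = −α·g_{m+1}. Then u_{m+1} > min_{1 ≤ j ≤ m} u_j, i.e. after the gradient step the weight of the newly trained tree strictly exceeds the smallest updated weight of the existing trees. -/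

import Mathlib

open scoped BigOperators RealInnerProductSpace

/-- A vector is one-hot if exactly one coordinate equals 1 and all others equal 0. -/
def IsOneHot {C : ℕ} (v : EuclideanSpace ℝ (Fin C)) : Prop :=
  ∃ c : Fin C, v c = 1 ∧ ∀ c' : Fin C, c' ≠ c → v c' = 0

theorem IsOneHot.exists_eq_single {C : ℕ} {v : EuclideanSpace ℝ (Fin C)} (hv : IsOneHot v) :
    ∃ c : Fin C, v = EuclideanSpace.single c 1 := by
  obtain ⟨c, hc, h0⟩ := hv
  refine ⟨c, ?_⟩
  ext i
  by_cases h : i = c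
  · subst h
    simp [hc]
  · simp [h, h0 i h]

theorem IsOneHot.inner_self {C : ℕ} {v : EuclideanSpace ℝ (Fin C)} (hv : IsOneHot v) :
    ⟪v, v⟫ = 1 := by
  obtain ⟨c, rfl⟩ := hv.exists_eq_single
  simp

theorem IsOneHot.inner_eq_zero {C : ℕ} {v v' : EuclideanSpace ℝ (Fin C)} (hv : IsOneHot v)
    (hv' : IsOneHot v') (hne : v ≠ v') : ⟪v, v'⟫ = 0 := by
  obtain ⟨c, rfl⟩ := hv.exists_eq_single
  obtain ⟨c', rfl⟩ := hv'.exists_eq_single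
  have h : c ≠ c' := fun h => hne (by rw [h])
  simp [EuclideanSpace.inner_single_left, h]

/-- Weights summing to one have an entry that is at most their average. -/
theorem exists_le_one_div_of_sum_eq_one {m : ℕ} (hm : 1 ≤ m) {w : Fin m → ℝ}
    (hw : ∑ j, w j = 1) : ∃ j, w j ≤ 1 / (m : ℝ) := by
  have hm0 : (m : ℝ) ≠ 0 := by positivity
  obtain ⟨j, -, hj⟩ := Finset.exists_le_of_sum_le (s := Finset.univ) (f := w)
    (g := fun _ => 1 / (m : ℝ)) ⟨⟨0, hm⟩, Finset.mem_univ _⟩ (by simp [hw, hm0])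
  exact ⟨j, hj⟩

/-- Theorem 1 of the paper, case `m = M`, key inequality: if every existing tree
misclassifies the new observation with the same one-hot prediction `e ≠ y_B`, then
after the gradient step with step size `α > BC/(4m)` the weight of the newly trained
tree strictly exceeds the smallest updated weight of the existing trees. -/
theorem shrub_new_tree_beats_smallest_weight
    (B C m : ℕ) (hB : 1 ≤ B) (hC : 1 ≤ C) (hm : 1 ≤ m)
    (α : ℝ) (hα : α > ((B : ℝ) * (C : ℝ)) / (4 * (m : ℝ)))
    (y : Fin B → EuclideanSpace ℝ (Fin C))
    (a : Fin m → Fin B → EuclideanSpace ℝ (Fin C))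
    (hy : ∀ i, IsOneHot (y i))
    (ha : ∀ j i, IsOneHot (a j i))
    (iB : Fin B) (hiB : (iB : ℕ) = B - 1)
    (hfit : ∀ (j : Fin m) (i : Fin B), i ≠ iB → a j i = y i)
    (e : EuclideanSpace ℝ (Fin C)) (he : IsOneHot e) (hey : e ≠ y iB)
    (hae : ∀ j : Fin m, a j iB = e)
    (w : Fin m → ℝ) (hw0 : ∀ j, 0 ≤ w j) (hw1 : ∑ j, w j = 1)
    (g : Fin m → ℝ)
    (hg : ∀ j : Fin m,
      g j = (2 / ((B : ℝ) * (C : ℝ))) * ∑ i, ⟪(∑ k, w k • a k i) - y i, a j i⟫)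
    (gnew : ℝ)
    (hgnew : gnew = (2 / ((B : ℝ) * (C : ℝ))) * ∑ i, ⟪(∑ k, w k • a k i) - y i, y i⟫)
    (u : Fin (m + 1) → ℝ)
    (hu : ∀ j : Fin m, u j.castSucc = w j - α * g j)
    (hunew : u (Fin.last m) = -(α * gnew)) :
    Finset.univ.inf' (Finset.univ_nonempty_iff.mpr ⟨⟨0, hm⟩⟩)
        (fun j : Fin m => u j.castSucc)
      < u (Fin.last m) := by
  have hf : ∀ i, i ≠ iB → (∑ k, w k • a k i) - y i = 0 := by
    intro i hi
    simp only [hfit _ i hi, ← Finset.sum_smul, hw1, one_smul, sub_self]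
  have hfB : (∑ k, w k • a k iB) = e := by
    simp only [hae, ← Finset.sum_smul, hw1, one_smul]
  have hsum : ∀ b : Fin B → EuclideanSpace ℝ (Fin C),
      ∑ i, ⟪(∑ k, w k • a k i) - y i, b i⟫ = ⟪e - y iB, b iB⟫ := by
    intro b
    rw [Finset.sum_eq_single iB, hfB]
    · intro i _ hi
      rw [hf i hi, inner_zero_left]
    · simp
  obtain ⟨j, hj⟩ := exists_le_one_div_of_sum_eq_one hm hw1
  refine (Finset.inf'_le _ (Finset.mem_univ j)).trans_lt ?_
  rw [hu, hunew, hg, hgnew, hsum, hsum, hae, inner_sub_left, inner_sub_left, he.inner_self,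
    (hy iB).inner_self, he.inner_eq_zero (hy iB) hey, (hy iB).inner_eq_zero he hey.symm]
  have hBC : (0 : ℝ) < (B : ℝ) * C := by positivity
  have hm0 : (0 : ℝ) < m := by positivity
  have hstep : 1 / (m : ℝ) < 4 * α / ((B : ℝ) * C) := by
    rw [gt_iff_lt, div_lt_iff₀ (by positivity)] at hα
    rw [div_lt_div_iff₀ hm0 hBC]
    linarith
  have hsplit : 4 * α / ((B : ℝ) * C) = 2 * (α * (2 / ((B : ℝ) * C))) := by ring
  linarith
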